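/- arXiv:2601.13012 — 2 statements merged into one kernel-verified Lean document; each statement's English description precedes it below -/
import Mathlib

section
/- Let λ > 0 be real, A = !![1, 0; 0, λ] ∈ M_2(ℂ), and H = (1/√2) • !![1, 1; 1, -1] the Hadamard matrix. Let e₀, e₁ be the standard basis vectors of ℂ². For a nonzero vector ψ, write N(ψ) := ⟪H ψ, A (H ψ)⟫ and let T(ψ) := (1/N(ψ)) • (H ψ)(H ψ)ᴴ denote the renormalized updated pure state. Then the updated density matrix of the computational-basis ensemble equals (1/(1+λ)) times the identity: (1/2) • T(e₀) + (1/2) • T(e₁) = (1/(1+λ)) • 1. -/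
open Matrix

/-- The Hadamard matrix `(1/√2) • !![1,1;1,-1]`. -/
noncomputable def Had : Matrix (Fin 2) (Fin 2) ℂ :=
  (1 / ((Real.sqrt 2 : ℝ) : ℂ)) • !![1, 1; 1, -1]

/-- The metric `A = !![1,0;0,λ]`. -/
noncomputable def Amat (l : ℝ) : Matrix (Fin 2) (Fin 2) ℂ := !![1, 0; 0, (l : ℂ)]

/-- Normalization factor `N(ψ) = ⟪H ψ, A (H ψ)⟫`. -/
noncomputable def Nfac (l : ℝ) (ψ : Fin 2 → ℂ) : ℂ :=
  star (Had.mulVec ψ) ⬝ᵥ (Amat l).mulVec (Had.mulVec ψ)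

/-- The renormalized updated pure state `T(ψ) = (1/N(ψ)) • (H ψ)(H ψ)ᴴ`. -/
noncomputable def Tupd (l : ℝ) (ψ : Fin 2 → ℂ) : Matrix (Fin 2) (Fin 2) ℂ :=
  (1 / Nfac l ψ) • Matrix.vecMulVec (Had.mulVec ψ) (star (Had.mulVec ψ))

theorem one_div_sqrt_two_mul_self :
    (1 / ((Real.sqrt 2 : ℝ) : ℂ)) * (1 / ((Real.sqrt 2 : ℝ) : ℂ)) = 1 / 2 := by
  rw [div_mul_div_comm, ← Complex.ofReal_mul, Real.mul_self_sqrt zero_le_two]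
  norm_num

theorem Tupd_of_mulVec (l : ℝ) (ψ : Fin 2 → ℂ) (e : ℝ) (he : e * e = 1)
    (h : Had.mulVec ψ = (1 / ((Real.sqrt 2 : ℝ) : ℂ)) • ![1, (e : ℂ)]) :
    Tupd l ψ = (1 / (1 + (l : ℂ))) • !![1, (e : ℂ); (e : ℂ), 1] := by
  have hs : star (1 / ((Real.sqrt 2 : ℝ) : ℂ)) = 1 / ((Real.sqrt 2 : ℝ) : ℂ) := by simp
  have hv : star (![1, (e : ℂ)]) = ![1, (e : ℂ)] := by
    ext i; fin_cases i <;> simp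
  have he' : (e : ℂ) * e = 1 := mod_cast he
  have hN : Nfac l ψ = (1 / 2) * (1 + (l : ℂ)) := by
    rw [Nfac, h, star_smul, hs, hv, mulVec_smul, smul_dotProduct, dotProduct_smul,
      smul_smul, one_div_sqrt_two_mul_self]
    simp [Amat, dotProduct, mulVec, Fin.sum_univ_two]
    linear_combination (l : ℂ) * he'
  have hP : vecMulVec ![1, (e : ℂ)] ![1, (e : ℂ)] = !![1, (e : ℂ); (e : ℂ), 1] := by
    ext i j; fin_cases i <;> fin_cases j <;> simp [vecMulVec_apply, he']
  rw [Tupd, hN, h, star_smul, hs, hv, smul_vecMulVec, vecMulVec_smul, smul_smul,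
    smul_smul, mul_assoc, one_div_sqrt_two_mul_self, hP]
  congr 1
  rw [one_div, mul_inv]
  ring

/-- The updated density matrix of the computational-basis ensemble equals
`(1/(1+λ)) • 1`. -/
theorem stmt_6 (l : ℝ) (hl : 0 < l) :
    (1 / 2 : ℂ) • Tupd l ![1, 0] + (1 / 2 : ℂ) • Tupd l ![0, 1] =
      (1 / (1 + (l : ℂ))) • (1 : Matrix (Fin 2) (Fin 2) ℂ) := by
  rw [Tupd_of_mulVec l ![1, 0] 1 (by norm_num)
      (by ext i; fin_cases i <;> simp [Had, mulVec, dotProduct]),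
    Tupd_of_mulVec l ![0, 1] (-1) (by norm_num)
      (by ext i; fin_cases i <;> simp [Had, mulVec, dotProduct])]
  ext i j
  fin_cases i <;> fin_cases j <;> simp <;> ring
end

section
/- Let A be a positive definite Hermitian n×n complex matrix and let ρ₁, ρ₂ be Hermitian n×n matrices with ρ₁ ≠ ρ₂. Then there exists a Hermitian matrix M such that trace(A * M * ρ₁) ≠ trace(A * M * ρ₂); i.e. the two states are distinguishable by some measurement in the modified probability rule. -/
open Matrix ComplexOrder

/-- For `A` positive definite, `Dᴴ * A * D` has zero trace only if `D = 0`. -/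
theorem Matrix.PosDef.eq_zero_of_trace_conjTranspose_mul_mul_eq_zero
    {m n : Type*} [Fintype m] [Fintype n] {A : Matrix m m ℂ} (hA : A.PosDef)
    {D : Matrix m n ℂ} (h : (Dᴴ * A * D).trace = 0) : D = 0 := by
  classical
  have h0 : Dᴴ * A * D = 0 :=
    (hA.posSemidef.conjTranspose_mul_mul_same D).trace_eq_zero_iff.mp h
  refine Matrix.ext_of_mulVec_single fun i => ?_
  by_contra hx
  rw [zero_mulVec] at hx
  have hpos := hA.dotProduct_mulVec_pos hx
  rw [star_mulVec, ← dotProduct_mulVec, mulVec_mulVec, mulVec_mulVec, h0,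
    zero_mulVec, dotProduct_zero] at hpos
  exact hpos.false

/-- Distinct Hermitian states are distinguishable in the modified probability rule:
if `ρ₁ ≠ ρ₂` then some Hermitian `M` gives `trace (A M ρ₁) ≠ trace (A M ρ₂)`. -/
theorem stmt_14 {n : ℕ} (A : Matrix (Fin n) (Fin n) ℂ) (hA : A.PosDef)
    (ρ₁ ρ₂ : Matrix (Fin n) (Fin n) ℂ) (h1 : ρ₁.IsHermitian) (h2 : ρ₂.IsHermitian)
    (hne : ρ₁ ≠ ρ₂) :
    ∃ M : Matrix (Fin n) (Fin n) ℂ, M.IsHermitian ∧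
      (A * M * ρ₁).trace ≠ (A * M * ρ₂).trace := by
  have hD := h1.sub h2
  refine ⟨ρ₁ - ρ₂, hD, fun h => hne (sub_eq_zero.mp ?_)⟩
  apply hA.eq_zero_of_trace_conjTranspose_mul_mul_eq_zero
  rw [hD.eq, Matrix.mul_assoc, Matrix.trace_mul_comm, Matrix.mul_assoc, ← sub_eq_zero.mpr h,
    ← trace_sub, ← Matrix.mul_sub, Matrix.mul_assoc]
end
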